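/- Let θ₀, θ₁ be nonvanishing holomorphic functions on ℍ such that θ₀ transforms with weight 1/2 and character ψ₀ and θ₁ with weight 3/2 and character ψ₁·(-1/·) under Γ₀(N) (N = lcm(4N₀², 4N₁²)), with the half-integral slash action. Fix an integer a and half-integer k ≥ 3/2, and define δ_a^{k-1}(f) := θ₀^{3a-2} θ₁^{1-a} D^{k-3/2}(θ₀^{1-3a} θ₁^{a} f). Then for every γ = (* *; c d) ∈ Γ₀(N) and every smooth f: ℍ → ℂ, δ_a^{k-1}(f|_{2-k}γ) = (-1/d)·(ψ₀(d)/ψ₁(d))·(δ_a^{k-1}(f))|_k γ. -/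

import Mathlib

set_option autoImplicit false

open Complex Real

/-- Kronecker symbol `(c/d)` for odd `d` (possibly negative). -/
def kroneckerOdd (c d : ℤ) : ℤ :=
  (if d < 0 ∧ c < 0 then -1 else 1) * jacobiSym c d.natAbs

/-- `ε_d = 1` if `d ≡ 1 (mod 4)`, `ε_d = i` if `d ≡ 3 (mod 4)`. -/
noncomputable def epsFac (d : ℤ) : ℂ := if d % 4 = 1 then 1 else Complex.I

/-- The half-integral weight slash action of the matrix `(a b; c d)` in weight `j/2`
(`j` an odd integer): `(f|_{j/2} γ)(z) = (c/d) ε_d^j (cz+d)^{-j/2} f(γz)`,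
with the principal branch of the complex power. -/
noncomputable def hslash (j : ℤ) (a b c d : ℤ) (f : ℂ → ℂ) : ℂ → ℂ :=
  fun z => (kroneckerOdd c d : ℂ) * epsFac d ^ j *
    ((c : ℂ) * z + (d : ℂ)) ^ (-(j : ℂ) / 2) *
    f (((a : ℂ) * z + (b : ℂ)) / ((c : ℂ) * z + (d : ℂ)))

/-- The Bol-style operator
`δ_a^{k-1}(f) = θ₀^{3a-2} θ₁^{1-a} D^{k-3/2}(θ₀^{1-3a} θ₁^a f)` of weight
`k = m + 3/2`, where `D^m = (2πi)^{-m} (d/dz)^m`. -/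
noncomputable def bolDelta (m : ℕ) (a : ℤ) (θ₀ θ₁ f : ℂ → ℂ) : ℂ → ℂ :=
  fun z => (θ₀ z) ^ (3 * a - 2) * (θ₁ z) ^ (1 - a) *
    ((2 * π * I) ^ (-(m : ℤ)) *
      iteratedDerivWithin m
        (fun w => (θ₀ w) ^ (1 - 3 * a) * (θ₁ w) ^ a * f w)
        {w : ℂ | 0 < w.im} z)


def upperH : Set ℂ := {w : ℂ | 0 < w.im}

lemma upperH_open : IsOpen upperH := isOpen_lt continuous_const Complex.continuous_im

lemma iter_hasDerivAt {g : ℂ → ℂ} (hg : DifferentiableOn ℂ g upperH) (n : ℕ) {z : ℂ}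
    (hz : z ∈ upperH) :
    HasDerivAt (iteratedDerivWithin n g upperH) (iteratedDerivWithin (n + 1) g upperH z) z := by
  have hc : ContDiffOn ℂ (n + 1 : ℕ) g upperH := hg.contDiffOn upperH_open
  have hd : DifferentiableOn ℂ (iteratedDerivWithin n g upperH) upperH :=
    hc.differentiableOn_iteratedDerivWithin (by exact_mod_cast Nat.lt_succ_self n)
      upperH_open.uniqueDiffOn
  have h1 := (hd.differentiableAt (upperH_open.mem_nhds hz)).hasDerivAt
  rw [iteratedDerivWithin_succ, derivWithin_of_isOpen upperH_open hz]
  exact h1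

lemma iter_succ_eq {g F : ℂ → ℂ} {n : ℕ}
    (hF : Set.EqOn (iteratedDerivWithin n g upperH) F upperH) {z F' : ℂ} (hz : z ∈ upperH)
    (h : HasDerivAt F F' z) : iteratedDerivWithin (n + 1) g upperH z = F' := by
  rw [iteratedDerivWithin_succ, derivWithin_of_isOpen upperH_open hz]
  have : iteratedDerivWithin n g upperH =ᶠ[nhds z] F :=
    Filter.eventuallyEq_of_mem (upperH_open.mem_nhds hz) hF
  rw [this.deriv_eq, h.deriv]

lemma affine_hasDerivAt (c d z : ℂ) : HasDerivAt (fun w => c * w + d) c z := by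
  simpa using ((hasDerivAt_id z).const_mul c).add_const d

lemma leibniz_affine {u : ℂ → ℂ} (hu : DifferentiableOn ℂ u upperH) (c d : ℂ) (n : ℕ) :
    ∀ z ∈ upperH, iteratedDerivWithin (n + 1) (fun w => (c * w + d) * u w) upperH z
      = (c * z + d) * iteratedDerivWithin (n + 1) u upperH z
        + (n + 1) * c * iteratedDerivWithin n u upperH z := by
  induction n with
  | zero =>
    intro z hz
    refine iter_succ_eq (F := fun w => (c * w + d) * iteratedDerivWithin 0 u upperH w)
      (fun w _ => by simp) hz ?_
    refine ((affine_hasDerivAt c d z).mul (iter_hasDerivAt hu 0 hz)).congr_deriv ?_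
    push_cast; ring
  | succ n ih =>
    intro z hz
    refine iter_succ_eq (F := fun z => (c * z + d) * iteratedDerivWithin (n + 1) u upperH z
        + (n + 1) * c * iteratedDerivWithin n u upperH z) ih hz ?_
    refine (((affine_hasDerivAt c d z).mul (iter_hasDerivAt hu (n+1) hz)).add
      ((iter_hasDerivAt hu n hz).const_mul ((n + 1) * c))).congr_deriv ?_
    push_cast; ring

lemma J_ne {a b c d : ℤ} (h : a * d - b * c = 1) {z : ℂ} (hz : z ∈ upperH) :
    (c : ℂ) * z + d ≠ 0 := by
  intro h0
  have hz : 0 < z.im := hz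
  have him := congrArg Complex.im h0
  have hre := congrArg Complex.re h0
  simp at him hre
  rcases him with hc | hc
  · subst hc
    simp at hre
    subst hre
    simp at h
  · exact hz.ne' hc

lemma mob_im {a b c d : ℤ} (h : a * d - b * c = 1) {z : ℂ} (hz : z ∈ upperH) :
    ((a : ℂ) * z + b) / ((c : ℂ) * z + d) ∈ upperH := by
  have hJ := J_ne h hz
  have hn := Complex.normSq_pos.mpr hJ
  have hz : 0 < z.im := hz
  have h' : (a : ℝ) * d - b * c = 1 := by exact_mod_cast h
  show 0 < (((a : ℂ) * z + b) / ((c : ℂ) * z + d)).im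
  have : (((a : ℂ) * z + b) / ((c : ℂ) * z + d)).im
      = z.im / Complex.normSq ((c : ℂ) * z + d) := by
    rw [Complex.div_im, div_sub_div_same]
    congr 1
    simp
    linear_combination z.im * h'
  rw [this]
  positivity

lemma mob_hasDerivAt {a b c d : ℤ} (h : a * d - b * c = 1) {z : ℂ} (hz : z ∈ upperH) :
    HasDerivAt (fun w : ℂ => ((a : ℂ) * w + b) / ((c : ℂ) * w + d))
      (((c : ℂ) * z + d) ^ (-2 : ℤ)) z := by
  have hJ := J_ne h hz
  have h' : (a : ℂ) * d - b * c = 1 := by exact_mod_cast h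
  refine ((affine_hasDerivAt a b z).div (affine_hasDerivAt c d z) hJ).congr_deriv ?_
  have e : (a : ℂ) * (c * z + d) - (a * z + b) * c = 1 := by linear_combination h'
  rw [e, zpow_neg, one_div]
  rfl

lemma J_zpow_hasDerivAt {a b c d : ℤ} (h : a * d - b * c = 1) {z : ℂ} (hz : z ∈ upperH) (k : ℤ) :
    HasDerivAt (fun w : ℂ => ((c : ℂ) * w + d) ^ k)
      (k * ((c : ℂ) * z + d) ^ (k - 1) * c) z :=
  HasDerivAt.comp (h₂ := fun x : ℂ => x ^ k) z
    (hasDerivAt_zpow k _ (Or.inl (J_ne h hz))) (affine_hasDerivAt c d z)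

lemma bol {a b c d : ℤ} (h : a * d - b * c = 1) {g : ℂ → ℂ} (hg : DifferentiableOn ℂ g upperH)
    (m : ℕ) : ∀ z ∈ upperH,
    iteratedDerivWithin m (fun w => ((c : ℂ) * w + d) ^ ((m : ℤ) - 1) *
        g (((a : ℂ) * w + b) / ((c : ℂ) * w + d))) upperH z
      = ((c : ℂ) * z + d) ^ (-(m : ℤ) - 1) *
        iteratedDerivWithin m g upperH (((a : ℂ) * z + b) / ((c : ℂ) * z + d)) := by
  induction m with
  | zero => intro z hz; simp
  | succ m ih =>
    intro z hz
    set u : ℂ → ℂ := fun w => ((c : ℂ) * w + d) ^ ((m : ℤ) - 1) *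
        g (((a : ℂ) * w + b) / ((c : ℂ) * w + d)) with hu
    have hud : DifferentiableOn ℂ u upperH := by
      intro w hw
      refine DifferentiableAt.differentiableWithinAt ?_
      refine (J_zpow_hasDerivAt h hw _).differentiableAt.mul ?_
      exact DifferentiableAt.comp w
        (hg.differentiableAt (upperH_open.mem_nhds (mob_im h hw)))
        (mob_hasDerivAt h hw).differentiableAt
    have e1 : Set.EqOn (fun w => ((c : ℂ) * w + d) ^ (((m + 1 : ℕ) : ℤ) - 1) *
        g (((a : ℂ) * w + b) / ((c : ℂ) * w + d))) (fun w => ((c : ℂ) * w + d) * u w) upperH := by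
      intro w hw
      have hJ := J_ne h hw
      simp only [hu]
      rw [← mul_assoc, ← zpow_one_add₀ hJ]
      congr 2
      push_cast; ring
    rw [iteratedDerivWithin_congr e1 hz, leibniz_affine hud _ _ _ z hz, ih z hz]
    have hJ := J_ne h hz
    have hcomp := (iter_hasDerivAt hg m (mob_im h hz)).comp z (mob_hasDerivAt h hz)
    have e2 := iter_succ_eq ih hz ((J_zpow_hasDerivAt h hz _).mul hcomp)
    rw [e2]
    have q1 : ((c : ℂ) * z + d) ^ (-(m : ℤ) - 1)
        = ((c : ℂ) * z + d) * ((c : ℂ) * z + d) ^ (-(m : ℤ) - 1 - 1) := by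
      rw [← zpow_one_add₀ hJ]; congr 1; ring
    have q2 : ((c : ℂ) * z + d) ^ (-((m + 1 : ℕ) : ℤ) - 1)
        = ((c : ℂ) * z + d) ^ (-(m : ℤ) - 1 - 1) := by
      congr 1; push_cast; ring
    have q3 : ((c : ℂ) * z + d) * ((c : ℂ) * z + d) * ((c : ℂ) * z + d) ^ (-2 : ℤ) = 1 := by
      rw [zpow_neg]; field_simp
    rw [q2, q1]
    push_cast
    linear_combination ((c : ℂ) * z + d) ^ (-(m : ℤ) - 1 - 1) *
      iteratedDerivWithin (m + 1) g upperH (((a : ℂ) * z + b) / ((c : ℂ) * z + d)) * q3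

lemma algA (p q κ ε s t u : ℂ) (hp : p ≠ 0) (hq : q ≠ 0) (hκ : κ ≠ 0) (hε : ε ≠ 0) (hs : s ≠ 0)
    (ht : t ≠ 0) (hu : u ≠ 0) (F : ℂ) (a m : ℤ) :
    (p⁻¹ * κ * ε * s⁻¹ * t) ^ (1 - 3 * a) * (q⁻¹ * κ * ε ^ (3 : ℤ) * s ^ (-3 : ℤ) * u) ^ a *
      (κ * ε ^ (1 - 2 * m) * s ^ (-(1 - 2 * m)) * F)
    = p ^ (3 * a - 1) * q ^ (-a) * κ ^ (2 - 2 * a) * ε ^ (2 - 2 * m) *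
      (s ^ (2 * (m - 1)) * (t ^ (1 - 3 * a) * u ^ a * F)) := by
  simp only [← mul_assoc]
  congr 1
  rw [← Complex.exp_log hp, ← Complex.exp_log hq, ← Complex.exp_log hκ, ← Complex.exp_log hε,
    ← Complex.exp_log hs, ← Complex.exp_log ht, ← Complex.exp_log hu]
  simp only [← Complex.exp_int_mul, ← Complex.exp_neg, ← Complex.exp_add]
  congr 1
  push_cast
  ring

lemma algB (p q κ ε s t u : ℂ) (hp : p ≠ 0) (hq : q ≠ 0) (hκ : κ ≠ 0) (hε : ε ≠ 0) (hs : s ≠ 0)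
    (ht : t ≠ 0) (hu : u ≠ 0) (P D : ℂ) (a m : ℤ) :
    (p⁻¹ * κ * ε * s⁻¹ * t) ^ (3 * a - 2) *
      (q⁻¹ * κ * ε ^ (3 : ℤ) * s ^ (-3 : ℤ) * u) ^ (1 - a) *
      (P * (p ^ (3 * a - 1) * q ^ (-a) * κ ^ (2 - 2 * a) * ε ^ (2 - 2 * m) *
        (s ^ (2 * (-m - 1)) * D)))
    = q⁻¹ * p * (κ * ε ^ (3 - 2 * m) * s ^ (-(2 * m + 3)) *
      (t ^ (3 * a - 2) * u ^ (1 - a) * (P * D))) := by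
  have key : (p⁻¹ * κ * ε * s⁻¹ * t) ^ (3 * a - 2) *
      (q⁻¹ * κ * ε ^ (3 : ℤ) * s ^ (-3 : ℤ) * u) ^ (1 - a) *
      (p ^ (3 * a - 1) * q ^ (-a) * κ ^ (2 - 2 * a) * ε ^ (2 - 2 * m) * s ^ (2 * (-m - 1)))
      = q⁻¹ * p * (κ * ε ^ (3 - 2 * m) * s ^ (-(2 * m + 3)) *
      (t ^ (3 * a - 2) * u ^ (1 - a))) := by
    rw [← Complex.exp_log hp, ← Complex.exp_log hq, ← Complex.exp_log hκ, ← Complex.exp_log hε,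
      ← Complex.exp_log hs, ← Complex.exp_log ht, ← Complex.exp_log hu]
    simp only [← Complex.exp_int_mul, ← Complex.exp_neg, ← Complex.exp_add]
    congr 1
    push_cast
    ring
  linear_combination (P * D) * key

lemma cpow_half (x : ℂ) (j : ℤ) : x ^ (-(j : ℂ) / 2) = (x ^ (1 / 2 : ℂ)) ^ (-j) := by
  rw [← Complex.cpow_mul_int]
  congr 1
  push_cast; ring

lemma half_sq (x : ℂ) : (x ^ (1 / 2 : ℂ)) ^ 2 = x := by
  rw [← Complex.cpow_mul_nat]; simp

lemma char_ne {M N : ℕ} (χ : DirichletCharacter ℂ M) {a b c d : ℤ} (h : a * d - b * c = 1)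
    (hMN : M ∣ N) (hc : (N : ℤ) ∣ c) : χ (d : ZMod M) ≠ 0 := by
  have hM : (M : ℤ) ∣ c := (Int.natCast_dvd_natCast.mpr hMN).trans hc
  have h0 : (c : ZMod M) = 0 := (ZMod.intCast_zmod_eq_zero_iff_dvd c M).mpr hM
  have h1 : (a : ZMod M) * d = 1 := by
    have := congrArg (Int.cast : ℤ → ZMod M) h
    push_cast at this
    rw [h0] at this
    simpa using this
  have hu : IsUnit (d : ZMod M) := IsUnit.of_mul_eq_one (a : ZMod M) (by rw [mul_comm]; exact h1)
  exact (hu.map χ).ne_zero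

lemma eps_four (d : ℤ) : epsFac d ^ 4 = 1 := by
  unfold epsFac; split_ifs <;> simp

lemma eps_ne (d : ℤ) : epsFac d ≠ 0 := by
  unfold epsFac; split_ifs <;> simp

lemma kron_sq {c d : ℤ} (h : (kroneckerOdd c d : ℂ) ≠ 0) :
    (kroneckerOdd c d : ℂ) * kroneckerOdd c d = 1 := by
  have h' : kroneckerOdd c d ≠ 0 := by exact_mod_cast h
  have : kroneckerOdd c d * kroneckerOdd c d = 1 := by
    revert h'
    unfold kroneckerOdd
    rcases jacobiSym.trichotomy c d.natAbs with e | e | e <;> rw [e] <;> split_ifs <;> simp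
  exact_mod_cast this

/-- for `γ ∈ Γ₀(N)`, `N = lcm(4N₀², 4N₁²)`, and nonvanishing theta
functions `θ₀` (weight `1/2`, character `ψ₀`) and `θ₁` (weight `3/2`, character
`ψ₁·(-1/·)`), the operator `δ_a^{k-1}` satisfies
`δ_a^{k-1}(f|_{2-k}γ) = (-1/d)·(ψ₀(d)/ψ₁(d))·(δ_a^{k-1} f)|_k γ`
(`k = m + 3/2`, so `2 - k = (1-2m)/2` and `k = (2m+3)/2`). -/
theorem bolDelta_slash_equivariance
    (N₀ N₁ : ℕ) [NeZero N₀] [NeZero N₁]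
    (ψ₀ : DirichletCharacter ℂ N₀) (ψ₁ : DirichletCharacter ℂ N₁)
    (hreal₀ : ∀ n : ℤ, (ψ₀ (n : ZMod N₀)).im = 0)
    (heven₀ : ψ₀ (-1) = 1) (hprim₀ : ψ₀.IsPrimitive)
    (hreal₁ : ∀ n : ℤ, (ψ₁ (n : ZMod N₁)).im = 0)
    (hodd₁ : ψ₁ (-1) = -1) (hprim₁ : ψ₁.IsPrimitive)
    (θ₀ θ₁ : ℂ → ℂ)
    (hθ₀ne : ∀ z : ℂ, 0 < z.im → θ₀ z ≠ 0)
    (hθ₁ne : ∀ z : ℂ, 0 < z.im → θ₁ z ≠ 0)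
    (hθ₀hol : DifferentiableOn ℂ θ₀ {w : ℂ | 0 < w.im})
    (hθ₁hol : DifferentiableOn ℂ θ₁ {w : ℂ | 0 < w.im})
    (N : ℕ) (hN : N = Nat.lcm (4 * N₀ ^ 2) (4 * N₁ ^ 2))
    -- θ₀ is modular of weight 1/2 and character ψ₀ on Γ₀(N)
    (hθ₀mod : ∀ a' b' c' d' : ℤ, a' * d' - b' * c' = 1 → (N : ℤ) ∣ c' →
      ∀ z : ℂ, 0 < z.im →
        hslash 1 a' b' c' d' θ₀ z = ψ₀ (d' : ZMod N₀) * θ₀ z)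
    -- θ₁ is modular of weight 3/2 and character ψ₁·(-1/·) on Γ₀(N)
    (hθ₁mod : ∀ a' b' c' d' : ℤ, a' * d' - b' * c' = 1 → (N : ℤ) ∣ c' →
      ∀ z : ℂ, 0 < z.im →
        hslash 3 a' b' c' d' θ₁ z
          = ψ₁ (d' : ZMod N₁) * (kroneckerOdd (-1) d' : ℂ) * θ₁ z)
    (m : ℕ) (a : ℤ) (f : ℂ → ℂ)
    (hf : DifferentiableOn ℂ f {w : ℂ | 0 < w.im}) :
    ∀ a' b' c' d' : ℤ, a' * d' - b' * c' = 1 → (N : ℤ) ∣ c' →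
      ∀ z : ℂ, 0 < z.im →
        bolDelta m a θ₀ θ₁ (hslash (1 - 2 * m) a' b' c' d' f) z
          = (kroneckerOdd (-1) d' : ℂ) * ψ₀ (d' : ZMod N₀) *
              (ψ₁ (d' : ZMod N₁))⁻¹ *
              hslash (2 * m + 3) a' b' c' d' (bolDelta m a θ₀ θ₁ f) z := by
  intro a' b' c' d' hdet hc z hz
  have hz' : z ∈ upperH := hz
  have hp₀ : ψ₀ (d' : ZMod N₀) ≠ 0 := char_ne ψ₀ hdet (N := N) (by
    rw [hN]; exact (Dvd.intro_left (4 * N₀) (by ring)).trans (Nat.dvd_lcm_left _ _)) hc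
  have hp₁ : ψ₁ (d' : ZMod N₁) ≠ 0 := char_ne ψ₁ hdet (N := N) (by
    rw [hN]; exact (Dvd.intro_left (4 * N₁) (by ring)).trans (Nat.dvd_lcm_right _ _)) hc
  have H₀ := hθ₀mod a' b' c' d' hdet hc
  have H₁ := hθ₁mod a' b' c' d' hdet hc
  clear hθ₀mod hθ₁mod
  set p₀ := ψ₀ (d' : ZMod N₀)
  set p₁ := ψ₁ (d' : ZMod N₁)
  have hκ : (kroneckerOdd c' d' : ℂ) ≠ 0 := by
    intro h0
    have := H₀ z hz
    simp only [hslash, h0, zero_mul] at this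
    exact mul_ne_zero hp₀ (hθ₀ne z hz) this.symm
  have hε := eps_ne d'
  have hχ : (kroneckerOdd (-1) d' : ℂ) ≠ 0 := by
    intro h0
    have := H₁ z hz
    simp only [hslash, h0, zero_mul, mul_zero] at this
    have hs := J_ne hdet hz'
    refine mul_ne_zero (mul_ne_zero (mul_ne_zero hκ (zpow_ne_zero _ hε)) ?_)
      (hθ₁ne _ (mob_im hdet hz')) this
    rw [cpow_half]
    apply zpow_ne_zero
    simp [Complex.cpow_eq_zero_iff, hs]
  have hχχ := kron_sq hχ
  have hε4 := eps_four d'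
  simp only [hslash, cpow_half] at H₀ H₁
  simp only [bolDelta, hslash, cpow_half]
  set κ : ℂ := (kroneckerOdd c' d' : ℂ)
  set χ : ℂ := (kroneckerOdd (-1) d' : ℂ)
  set ε : ℂ := epsFac d'
  set g : ℂ → ℂ := fun w => (θ₀ w) ^ (1 - 3 * a) * (θ₁ w) ^ a * f w with hgdef
  have hg : DifferentiableOn ℂ g upperH :=
    ((hθ₀hol.zpow (Or.inl hθ₀ne)).mul (hθ₁hol.zpow (Or.inl hθ₁ne))).mul hf
  -- formulas for the theta functions
  have T₀ : ∀ w ∈ upperH, θ₀ w = p₀⁻¹ * κ * ε * (((c' : ℂ) * w + d') ^ (1 / 2 : ℂ))⁻¹ *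
      θ₀ (((a' : ℂ) * w + b') / ((c' : ℂ) * w + d')) := by
    intro w hw
    have := H₀ w hw
    rw [zpow_one, zpow_neg_one] at this
    rw [mul_assoc p₀⁻¹, mul_assoc p₀⁻¹, mul_assoc p₀⁻¹, this, inv_mul_cancel_left₀ hp₀]
  have T₁ : ∀ w ∈ upperH, θ₁ w = (p₁ * χ)⁻¹ * κ * ε ^ (3 : ℤ) *
      (((c' : ℂ) * w + d') ^ (1 / 2 : ℂ)) ^ (-3 : ℤ) *
      θ₁ (((a' : ℂ) * w + b') / ((c' : ℂ) * w + d')) := by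
    intro w hw
    have := H₁ w hw
    rw [mul_assoc (p₁ * χ)⁻¹, mul_assoc (p₁ * χ)⁻¹, mul_assoc (p₁ * χ)⁻¹, this,
      inv_mul_cancel_left₀ (mul_ne_zero hp₁ hχ)]
  have hs : ∀ w ∈ upperH, ((c' : ℂ) * w + d') ^ (1 / 2 : ℂ) ≠ 0 := by
    intro w hw
    simp [Complex.cpow_eq_zero_iff, J_ne hdet hw]
  set C : ℂ := p₀ ^ (3 * a - 1) * (p₁ * χ) ^ (-a) * κ ^ (2 - 2 * a) * ε ^ (2 - 2 * (m : ℤ)) with hC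
  have hJm : ∀ (w : ℂ) (i : ℤ), ((c' : ℂ) * w + d') ^ i
      = (((c' : ℂ) * w + d') ^ (1 / 2 : ℂ)) ^ (2 * i) := by
    intro w i
    rw [zpow_mul]
    congr 1
    exact (half_sq _).symm
  have E : Set.EqOn (fun w => (θ₀ w) ^ (1 - 3 * a) * (θ₁ w) ^ a *
      (κ * ε ^ (1 - 2 * (m : ℤ)) * (((c' : ℂ) * w + d') ^ (1 / 2 : ℂ)) ^ (-(1 - 2 * (m : ℤ))) *
        f (((a' : ℂ) * w + b') / ((c' : ℂ) * w + d'))))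
      (fun w => C * (((c' : ℂ) * w + d') ^ ((m : ℤ) - 1) *
        g (((a' : ℂ) * w + b') / ((c' : ℂ) * w + d')))) upperH := by
    intro w hw
    have hsw := hs w hw
    simp only [hgdef, hC]
    rw [T₀ w hw, T₁ w hw, hJm w]
    exact algA _ _ _ _ _ _ _ hp₀ (mul_ne_zero hp₁ hχ) hκ hε hsw
      (hθ₀ne _ (mob_im hdet hw)) (hθ₁ne _ (mob_im hdet hw)) _ _ _
  have hnn := iteratedDerivWithin_congr (n := m) E hz'
  rw [iteratedDerivWithin_const_mul_field, bol hdet hg m z hz', hJm z] at hnn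
  have hnn' := hnn
  change iteratedDerivWithin m _ {w : ℂ | 0 < w.im} z = _ at hnn'
  rw [hnn', T₀ z hz', T₁ z hz', hC]
  rw [algB _ _ _ _ _ _ _ hp₀ (mul_ne_zero hp₁ hχ) hκ hε (hs z hz')
      (hθ₀ne _ (mob_im hdet hz')) (hθ₁ne _ (mob_im hdet hz'))]
  have e1 : (p₁ * χ)⁻¹ = χ * p₁⁻¹ := by
    rw [mul_inv, mul_comm, ← eq_inv_of_mul_eq_one_left hχχ]
  have e2 : ε ^ (3 - 2 * (m : ℤ)) = ε ^ (2 * (m : ℤ) + 3) := by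
    have : (2 * (m : ℤ) + 3) = (3 - 2 * (m : ℤ)) + (4 : ℕ) * m := by push_cast; ring
    rw [this, zpow_add₀ hε, zpow_mul, zpow_natCast ε 4, hε4, one_zpow, mul_one]
  rw [e1, e2]
  have e3 : χ * p₁⁻¹ * p₀ = χ * p₀ * p₁⁻¹ := by ring
  rw [e3]
  rfl
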